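/- Let q be a prime power of characteristic p and let n be an integer with 3 ≤ n ≤ p. If q ≥ (n−1)^2 · 2^{2 n ω(q−1)}, then 𝔽_q contains n consecutive primitive elements. -/

import Mathlib

open Finset

/-- An element `g` of a finite field is primitive if it generates the multiplicative
group of nonzero elements, i.e. every nonzero element is a power of `g`. -/
def IsPrimitiveElem {F : Type*} [Field F] (g : F) : Prop :=
  ∀ x : F, x ≠ 0 → ∃ k : ℕ, g ^ k = x

/-- The field `F` contains `n` consecutive distinct primitive elements: there is `g`
such that `g, g+1, …, g+n-1` are `n` distinct primitive elements. -/
def HasConsecutivePrimitives (F : Type*) [Field F] (n : ℕ) : Prop :=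
  ∃ g : F, (∀ k : ℕ, k < n → IsPrimitiveElem (g + (k : F))) ∧
    ∀ i : ℕ, i < n → ∀ j : ℕ, j < n → g + (i : F) = g + (j : F) → i = j

section

open Polynomial

theorem natDegree_resultant_le {K : Type*} [Field K] (f g : K[X][X]) (m n a b : ℕ)
    (hf : ∀ i, (f.coeff i).natDegree ≤ a) (hg : ∀ i, (g.coeff i).natDegree ≤ b) :
    (resultant f g m n).natDegree ≤ m * b + n * a := by
  have key : ∀ i j, (sylvester f g m n i j).natDegree ≤
      Fin.addCases (motive := fun _ => ℕ) (fun _ : Fin m => b) (fun _ : Fin n => a) j := by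
    intro i j
    induction j using Fin.addCases with
    | left j =>
      simp only [sylvester, Matrix.of_apply, Fin.addCases_left]
      split_ifs
      · exact hg _
      · simp
    | right j =>
      simp only [sylvester, Matrix.of_apply, Fin.addCases_right]
      split_ifs
      · exact hf _
      · simp
  rw [resultant, Matrix.det_apply]
  refine natDegree_sum_le_of_forall_le _ _ fun σ _ => ?_
  refine (natDegree_smul_le _ _).trans ((natDegree_prod_le _ _).trans ?_)
  refine (Finset.sum_le_sum fun j _ => key (σ j) j).trans ?_
  rw [Fin.sum_univ_add]
  simp

theorem coeff_zero_pow_of_dvd_X_pow_sub_C {L : Type*} [Field L] {d : ℕ} {t : L} {h : L[X]}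
    (hm : h.Monic) (hdvd : h ∣ X ^ d - C t) :
    h.coeff 0 ^ d = ((-1) ^ h.natDegree) ^ d * t ^ h.natDegree := by
  let Ω := AlgebraicClosure L
  have hinj := (algebraMap L Ω).injective
  apply hinj
  have hs := IsAlgClosed.splits (h.map (algebraMap L Ω))
  have h1 := hs.coeff_zero_eq_prod_roots_of_monic (hm.map _)
  have hroot : ∀ y ∈ (h.map (algebraMap L Ω)).roots, y ^ d = algebraMap L Ω t := by
    intro y hy
    have h2 := (Polynomial.map_dvd (algebraMap L Ω) hdvd)
    have := (isRoot_of_mem_roots hy).dvd h2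
    simp [sub_eq_zero] at this
    exact this
  have hcard : (h.map (algebraMap L Ω)).roots.card = h.natDegree := by
    rw [← hs.natDegree_eq_card_roots, natDegree_map]
  rw [coeff_map, natDegree_map] at h1
  have hprod := Multiset.prod_map_pow (m := (h.map (algebraMap L Ω)).roots) (f := id) (n := d)
  simp only [id, Multiset.map_id'] at hprod
  rw [map_pow, h1, mul_pow, ← hprod, Multiset.map_congr rfl hroot]
  simp [hcard]

/-- `f` is not a proper power up to `d`-th powers and constants. -/
def PowerFree {K : Type*} [Field K] (f : K[X]) (d : ℕ) : Prop :=
  ∀ (e : ℕ) (u v : K[X]) (c : K), u ≠ 0 → v ≠ 0 → c ≠ 0 → u ^ d * f ^ e = C c * v ^ d → d ∣ e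

theorem isCoprime_of_powerFree {K L : Type*} [Field K] [Field L] [Algebra K[X] L]
    [IsFractionRing K[X] L] {f : K[X]} {d : ℕ} (hd : 0 < d) (hf0 : f ≠ 0) (hf : PowerFree f d)
    {γ : K} (hγ : γ ≠ 0) {ρ : L[X]} (hρ : ρ ≠ 0) (hρd : ρ.natDegree < d) :
    IsCoprime ρ (X ^ d - C (algebraMap K[X] L (C γ) / algebraMap K[X] L f)) := by
  classical
  set φ := algebraMap K[X] L with hφ
  have hinj : Function.Injective φ := IsFractionRing.injective K[X] L
  have hφf : φ f ≠ 0 := by simpa using hinj.ne hf0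
  have hφγ : φ (C γ) ≠ 0 := by simpa using hinj.ne (C_ne_zero.mpr hγ)
  set t := φ (C γ) / φ f with ht
  set h := gcd ρ (X ^ d - C t) with hh
  have hne : h ≠ 0 := by simp [hh, _root_.gcd_eq_zero_iff, hρ]
  have hmon : h.Monic := by
    have := Polynomial.monic_normalize hne
    rwa [hh, _root_.normalize_gcd] at this
  have hpow := coeff_zero_pow_of_dvd_X_pow_sub_C hmon (gcd_dvd_right ρ (X ^ d - C t))
  obtain ⟨u, v, hv, huv⟩ := IsFractionRing.div_surjective (A := K[X]) (h.coeff 0)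
  have hv0 : v ≠ 0 := nonZeroDivisors.ne_zero hv
  have hφv : φ v ≠ 0 := by simpa using hinj.ne hv0
  have ht0 : t ≠ 0 := div_ne_zero hφγ hφf
  have hc0 : h.coeff 0 ≠ 0 := by
    intro h0
    rw [h0, zero_pow hd.ne'] at hpow
    have : ((-1 : L) ^ h.natDegree) ^ d * t ^ h.natDegree ≠ 0 := by simp [ht0]
    exact this hpow.symm
  have hu0 : u ≠ 0 := by
    rintro rfl
    simp at huv
    exact hc0 huv.symm
  have heq : u ^ d * f ^ h.natDegree = C (((-1) ^ h.natDegree) ^ d * γ ^ h.natDegree) * v ^ d := by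
    apply hinj
    rw [← huv, ht, div_pow, div_pow] at hpow
    field_simp at hpow
    simp only [map_mul, map_pow, map_neg, map_one]
    rw [← hφ] at hpow
    rw [← hpow]; field_simp
  have hdiv : d ∣ h.natDegree := hf _ _ _ _ hu0 hv0 (by simp [hγ]) heq
  have hle : h.natDegree ≤ ρ.natDegree := natDegree_le_of_dvd (gcd_dvd_left _ _) hρ
  have h0 : h.natDegree = 0 := Nat.eq_zero_of_dvd_of_lt hdiv (by omega)
  rw [← gcd_isUnit_iff]
  change IsUnit h
  rw [eq_one_of_monic_natDegree_zero hmon h0]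
  exact isUnit_one

theorem eq_zero_of_dvd_eval {K : Type*} [Field K] {f : K[X]} {d M A N : ℕ} (hd : 0 < d)
    (hf0 : f ≠ 0) (hfN : f.natDegree ≤ N) (hf : PowerFree f d) {γ α : K} (hγ : γ ≠ 0) {y : K[X]}
    (hy : (X - C α) ^ M ∣ f * y ^ d - C γ) {ρ : K[X][X]} (hρd : ρ.natDegree < d)
    (hρA : ∀ i, (ρ.coeff i).natDegree ≤ A) (hM : d * (A + N) < M)
    (hρ : (X - C α) ^ M ∣ ρ.eval y) : ρ = 0 := by
  by_contra hρ0
  set π : K[X][X] := C f * X ^ d - C (C γ) with hπ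
  have hπd : π.natDegree = d := by
    rw [hπ, natDegree_sub_C, natDegree_C_mul_X_pow _ _ hf0]
  have hπc : ∀ i, (π.coeff i).natDegree ≤ N := by
    intro i
    rw [hπ, coeff_sub, coeff_C_mul_X_pow, coeff_C]
    refine (natDegree_sub_le _ _).trans (max_le ?_ ?_)
    · split_ifs <;> simp [hfN]
    · split_ifs <;> simp
  have hR0 : ρ.resultant π ≠ 0 := by
    let L := FractionRing K[X]
    set φ := algebraMap K[X] L with hφ
    have hinj : Function.Injective φ := IsFractionRing.injective K[X] L
    have hφf : φ f ≠ 0 := by simpa using hinj.ne hf0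
    have hcop : IsCoprime (ρ.map φ) (π.map φ) := by
      have h1 : π.map φ = C (φ f) * (X ^ d - C (φ (C γ) / φ f)) := by
        rw [mul_sub, ← C_mul, mul_div_cancel₀ _ hφf]
        simp [hπ]
      rw [h1, isCoprime_mul_unit_left_right (isUnit_C.mpr hφf.isUnit)]
      exact isCoprime_of_powerFree hd hf0 hf hγ ((Polynomial.map_ne_zero_iff hinj).mpr hρ0)
        (by rwa [natDegree_map_eq_of_injective hinj])
    have h2 := resultant_ne_zero _ _ hcop
    rw [natDegree_map_eq_of_injective hinj, natDegree_map_eq_of_injective hinj,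
      resultant_map_map] at h2
    exact fun h => h2 (by rw [h, map_zero])
  obtain ⟨p, q, -, -, hpq⟩ := exists_mul_add_mul_eq_C_resultant ρ π le_rfl le_rfl
    (Or.inr (by omega))
  have hdvd : (X - C α) ^ M ∣ ρ.resultant π := by
    have h3 := congrArg (eval y) hpq
    simp only [eval_add, eval_mul, eval_C] at h3
    rw [← h3]
    refine dvd_add (hρ.mul_right _) (Dvd.dvd.mul_right ?_ _)
    simpa [hπ] using hy
  have hdeg := natDegree_resultant_le ρ π ρ.natDegree π.natDegree A N hρA hπc
  refine hR0 (eq_zero_of_dvd_of_natDegree_lt hdvd ?_)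
  rw [natDegree_pow, natDegree_X_sub_C, mul_one]
  rw [hπd] at hdeg
  rw [hπd]
  nlinarith [Nat.mul_le_mul_right N hρd.le]

theorem stepanov_sum_ne_zero {K : Type*} [Field K] {f : K[X]} {d E B A N : ℕ} (hd : 0 < d)
    (hfN : f.natDegree ≤ N) (hf : PowerFree f d) {p t : ℕ} [ExpChar K p] (hM : d * E + 1 = p ^ t)
    {α : K} (hα : f.eval α ≠ 0) (hAN : d * (A + N) < p ^ t) (r : Fin B → Fin d → K[X])
    (hr : ∀ k j, (r k j).natDegree ≤ A)
    (hsum : ∑ k, ∑ j, r k j * ((X - C α) ^ p ^ t) ^ (k : ℕ) * f ^ ((j : ℕ) * E) = 0) (k : Fin B)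
    (j : Fin d) : r k j = 0 := by
  set G := (X - C α) ^ p ^ t with hG
  have hf0 : f ≠ 0 := by rintro rfl; simp at hα
  have hG0 : G ≠ 0 := pow_ne_zero _ (X_sub_C_ne_zero α)
  have hpoly : G ∣ f * (f ^ E) ^ d - C (f.eval α ^ p ^ t) := by
    have h1 : f * (f ^ E) ^ d = f ^ p ^ t := by rw [← hM]; ring
    have : ExpChar K[X] p := inferInstance
    rw [h1, C_pow, ← sub_pow_expChar_pow, hG]
    exact pow_dvd_pow_of_dvd (dvd_iff_isRoot.mpr (by simp)) _
  suffices H : ∀ m : ℕ, ∀ k : Fin B, (k : ℕ) = m → ∀ j, r k j = 0 from H k k rfl j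
  intro m
  induction m using Nat.strong_induction_on with
  | _ m ih =>
  rintro k rfl
  have hsplit : ∑ i, ∑ j, r i j * G ^ (i : ℕ) * f ^ ((j : ℕ) * E) =
      (∑ j, r k j * G ^ (k : ℕ) * f ^ ((j : ℕ) * E)) +
        ∑ i ∈ univ.erase k, ∑ j, r i j * G ^ (i : ℕ) * f ^ ((j : ℕ) * E) :=
    (add_sum_erase _ _ (mem_univ k)).symm
  have hdvd : G ^ ((k : ℕ) + 1) ∣ ∑ j, r k j * G ^ (k : ℕ) * f ^ ((j : ℕ) * E) := by
    rw [hsum] at hsplit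
    rw [eq_neg_of_add_eq_zero_left hsplit.symm, dvd_neg]
    refine dvd_sum fun i hi => dvd_sum fun j _ => ?_
    rcases lt_trichotomy (i : ℕ) k with hlt | heq | hgt
    · simp [ih i hlt i rfl j]
    · exact absurd (Fin.ext heq) (ne_of_mem_erase hi)
    · exact ((pow_dvd_pow G hgt).mul_left _).mul_right _
  have hdvd' : G ∣ ∑ j, r k j * f ^ ((j : ℕ) * E) := by
    have h2 : ∑ j, r k j * G ^ (k : ℕ) * f ^ ((j : ℕ) * E) =
        G ^ (k : ℕ) * ∑ j, r k j * f ^ ((j : ℕ) * E) := by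
      rw [mul_sum]
      exact sum_congr rfl fun j _ => by ring
    rw [h2, pow_succ] at hdvd
    exact (mul_dvd_mul_iff_left (pow_ne_zero _ hG0)).mp hdvd
  set ρ : K[X][X] := ∑ j : Fin d, C (r k j) * X ^ (j : ℕ) with hρ
  have hcoeff : ∀ i, ρ.coeff i = if h : i < d then r k ⟨i, h⟩ else 0 := by
    intro i
    simp only [hρ, finsetSum_coeff, coeff_C_mul_X_pow]
    split_ifs with h
    · rw [sum_eq_single ⟨i, h⟩]
      · simp
      · intro b _ hb
        rw [if_neg]
        rintro rfl
        exact hb rfl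
      · simp
    · exact sum_eq_zero fun b _ => if_neg (by have := b.2; omega)
  have hρ0 : ρ = 0 := by
    refine eq_zero_of_dvd_eval (y := f ^ E) hd hf0 hfN hf (pow_ne_zero (p ^ t) hα) hpoly ?_ ?_ hAN
      ?_
    · refine (natDegree_le_iff_coeff_eq_zero (n := d - 1)).mpr (fun i hi => ?_) |>.trans_lt
        (by omega)
      rw [hcoeff, dif_neg (by omega)]
    · intro i
      rw [hcoeff]
      split_ifs
      · exact hr _ _
      · simp
    · convert hdvd' using 1
      rw [hρ, eval_finsetSum]
      exact sum_congr rfl fun j _ => by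
        rw [eval_mul, eval_C, eval_pow, eval_X, ← pow_mul, mul_comm E]
  intro j
  have := hcoeff j
  rw [hρ0] at this
  simpa using this.symm

theorem stepanov_card_le {K : Type*} [Field K] [Fintype K] [DecidableEq K] {f : K[X]}
    {d E B A N : ℕ} (hd : 0 < d) (hfN : f.natDegree ≤ N) (hf : PowerFree f d) {p t : ℕ}
    [ExpChar K p] (hM : d * E + 1 = p ^ t) (hQ : Fintype.card K = (p ^ t) ^ 2)
    (hAN : d * (A + N) < p ^ t)
    (hdim : A * p ^ t + B + p ^ t * N < d * B * (A + 1)) (c : K) :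
    #{x : K | f.eval x ^ (E * (p ^ t + 1)) = c ∧ f.eval x ≠ 0} ≤ A + (B + N) * p ^ t := by
  rcases ({x : K | f.eval x ^ (E * (p ^ t + 1)) = c ∧ f.eval x ≠ 0} : Finset K).eq_empty_or_nonempty
    with hemp | ⟨α, hα⟩
  · simp [hemp]
  simp only [mem_filter, mem_univ, true_and] at hα
  set M := p ^ t with hMdef
  have hMpos : 0 < M := by omega
  have hfrob : ∀ z : K, (z ^ M) ^ M = z := fun z => by
    rw [← pow_mul, ← sq, ← hQ, FiniteField.pow_card]
  have hdEN : ∀ j : ℕ, j < d → j * E * N ≤ M * N := fun j hj =>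
    Nat.mul_le_mul_right N (by nlinarith [Nat.mul_le_mul_right E hj.le])
  let ι := Fin B × Fin d × Fin (A + 1)
  let τ : ι → K[X] := fun i => X ^ ((i.2.2 : ℕ) * M) * (X - C α) ^ (i.1 : ℕ) * C (c ^ (i.2.1 : ℕ)) *
    f ^ ((d - 1 - (i.2.1 : ℕ)) * E)
  set L := A * M + B + M * N with hL
  have hτ : ∀ i, τ i ∈ degreeLT K L := by
    intro i
    rw [mem_degreeLT]
    refine (degree_le_natDegree).trans_lt ?_
    have h1 : (τ i).natDegree ≤ (i.2.2 : ℕ) * M + i.1 + 0 + (d - 1 - (i.2.1 : ℕ)) * E * N := by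
      refine natDegree_mul_le_of_le (natDegree_mul_le_of_le (natDegree_mul_le_of_le ?_ ?_) ?_) ?_
      · simp
      · simp
      · simp
      · exact natDegree_pow_le_of_le _ hfN
    have h2 := hdEN (d - 1 - i.2.1) (by omega)
    have h3 : (i.2.2 : ℕ) * M ≤ A * M := Nat.mul_le_mul_right _ (by have := i.2.2.2; omega)
    have h4 := i.1.2
    have h5 : (τ i).natDegree < L := by omega
    exact_mod_cast h5
  let T : (ι → K) →ₗ[K] degreeLT K L := Fintype.linearCombination K fun i =>
    (⟨τ i, hτ i⟩ : degreeLT K L)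
  have hker : LinearMap.ker T ≠ ⊥ := by
    apply LinearMap.ker_ne_bot_of_finrank_lt
    rw [(degreeLTEquiv K L).finrank_eq, Module.finrank_fin_fun, Module.finrank_fintype_fun_eq_card]
    simp only [ι, Fintype.card_prod, Fintype.card_fin]
    calc L < _ := hdim
      _ = _ := by ring
  obtain ⟨β, hβ, hβ0⟩ := (Submodule.ne_bot_iff _).mp hker
  have hTβ : ∑ i, C (β i) * τ i = 0 := by
    have h6 : T β = 0 := hβ
    have h7 := congrArg Subtype.val h6
    simpa [T, Fintype.linearCombination_apply, smul_eq_C_mul] using h7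
  let r : Fin B → Fin d → K[X] := fun k j => ∑ a : Fin (A + 1), C (β (k, j, a) ^ M) * X ^ (a : ℕ)
  have hr : ∀ k j, (r k j).natDegree ≤ A := fun k j =>
    natDegree_sum_le_of_forall_le _ _ fun a _ =>
      (natDegree_C_mul_X_pow_le _ _).trans (by have := a.2; omega)
  set Φ := ∑ k, ∑ j, r k j * ((X - C α) ^ M) ^ (k : ℕ) * f ^ ((j : ℕ) * E) with hΦ
  have hΦ0 : Φ ≠ 0 := by
    intro h0
    apply hβ0
    ext ⟨k, j, a⟩
    have h8 := stepanov_sum_ne_zero hd hfN hf hM hα.2 hAN r hr h0 k j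
    have h9 := congrArg (fun g => g.coeff (a : ℕ)) h8
    simp only [r, finsetSum_coeff, coeff_C_mul_X_pow, coeff_zero] at h9
    rw [sum_eq_single a] at h9
    · simpa [hMpos.ne'] using h9
    · intro b _ hb
      exact if_neg fun h => hb (Fin.ext h.symm)
    · simp
  have hΦdeg : Φ.natDegree ≤ A + (B + N) * M := by
    refine natDegree_sum_le_of_forall_le _ _ fun k _ => natDegree_sum_le_of_forall_le _ _ fun j _ =>
      ?_
    have h1 : (r k j * ((X - C α) ^ M) ^ (k : ℕ) * f ^ ((j : ℕ) * E)).natDegree ≤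
        A + k * M + j * E * N := by
      refine natDegree_mul_le_of_le (natDegree_mul_le_of_le (hr k j) ?_) ?_
      · rw [natDegree_pow, natDegree_pow, natDegree_X_sub_C, mul_one]
      · exact natDegree_pow_le_of_le _ hfN
    have h2 := hdEN j j.2
    have h3 : (k : ℕ) * M ≤ B * M := Nat.mul_le_mul_right _ k.2.le
    nlinarith
  have hroots : ({x : K | f.eval x ^ (E * (M + 1)) = c ∧ f.eval x ≠ 0} : Finset K) ⊆
      Φ.roots.toFinset := by
    intro x hx
    simp only [mem_filter, mem_univ, true_and] at hx
    obtain ⟨hx, hx0⟩ := hx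
    rw [Multiset.mem_toFinset, mem_roots hΦ0, IsRoot.def]
    set y := f.eval x with hy
    have hyj : ∀ j : Fin d, y ^ ((d - 1) * E) * y ^ ((j : ℕ) * E * M) =
        c ^ (j : ℕ) * y ^ ((d - 1 - (j : ℕ)) * E) := by
      intro j
      rw [← hx, ← pow_mul, ← pow_add, ← pow_add]
      congr 1
      have : d - 1 = (d - 1 - (j : ℕ)) + j := by omega
      rw [this]
      simp only [Nat.add_sub_cancel]
      ring
    have hpow : y ^ ((d - 1) * E) * Φ.eval x ^ M = 0 := by
      have h10 := congrArg (eval x) hTβ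
      rw [eval_zero] at h10
      rw [← h10, hΦ, eval_finsetSum, hMdef, sum_pow_char_pow, ← hMdef, mul_sum, eval_finsetSum,
        Fintype.sum_prod_type]
      refine sum_congr rfl fun k _ => ?_
      rw [eval_finsetSum, hMdef, sum_pow_char_pow, ← hMdef, mul_sum, Fintype.sum_prod_type]
      refine sum_congr rfl fun j _ => ?_
      simp only [r, eval_mul, eval_finsetSum, eval_C, eval_pow, eval_X, eval_sub, mul_pow, ← hy, τ]
      rw [hMdef, sum_pow_char_pow, ← hMdef, sum_mul, sum_mul, mul_sum]
      refine sum_congr rfl fun a _ => ?_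
      rw [mul_pow, hfrob, ← pow_mul _ (k : ℕ) M, mul_comm (k : ℕ) M, pow_mul _ M (k : ℕ), hfrob,
        ← pow_mul y, ← pow_mul x]
      linear_combination (β (k, j, a) * x ^ ((a : ℕ) * M) * (x - α) ^ (k : ℕ)) * hyj j
    have := (mul_eq_zero.mp hpow).resolve_left (pow_ne_zero _ hx0)
    exact pow_eq_zero_iff hMpos.ne' |>.mp this
  calc _ ≤ _ := card_le_card hroots
    _ ≤ _ := Multiset.toFinset_card_le _
    _ ≤ _ := card_roots' _
    _ ≤ _ := hΦdeg

theorem stepanov_bound {K : Type*} [Field K] [Fintype K] [DecidableEq K] {f : K[X]}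
    {d E N : ℕ} (hd : 0 < d) (hfN : f.natDegree ≤ N) (hf : PowerFree f d) {p t : ℕ}
    [ExpChar K p] (hM : d * E + 1 = p ^ t) (hQ : Fintype.card K = (p ^ t) ^ 2) (c : K) :
    d * #{x : K | f.eval x ^ (E * (p ^ t + 1)) = c ∧ f.eval x ≠ 0} ≤
      (p ^ t) ^ 2 + d * (4 * d * N + N + 11) * p ^ t := by
  set M := p ^ t with hMdef
  rcases lt_or_ge M (2 * (d * N + 3)) with hlt | hge
  · have h1 : #{x : K | f.eval x ^ (E * (M + 1)) = c ∧ f.eval x ≠ 0} ≤ M ^ 2 := by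
      rw [← hQ]; exact card_le_univ _
    have h2 : M ^ 2 ≤ (4 * d * N + N + 11) * M := by rw [sq]; gcongr; nlinarith
    calc _ ≤ d * M ^ 2 := by gcongr
      _ ≤ d * ((4 * d * N + N + 11) * M) := by gcongr
      _ ≤ _ := by rw [← mul_assoc d (_ + _ + _)]; exact Nat.le_add_left _ _
  · have hNE : N ≤ E := by
      by_contra! h
      nlinarith
    obtain ⟨A, rfl⟩ := Nat.exists_eq_add_of_le hNE
    have h3 := stepanov_card_le (A := A) (B := N + A + 2 * (2 + d * N)) hd hfN hf hM hQ
      (by rw [← hMdef, ← hM, add_comm A]; omega) (by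
        rw [← hMdef, ← hM]
        have h4 : d * N + 5 ≤ d * A := by nlinarith
        have h5 : N ≤ d * N := Nat.le_mul_of_pos_left _ hd
        have h6 : A ≤ d * A := Nat.le_mul_of_pos_left _ hd
        have h7 : N * (d * A) ≤ d * N * (d * A) := by gcongr
        have h8 : N * (d * N) ≤ d * N * (d * A) := Nat.mul_le_mul h5 (by omega)
        have h9 : d * N ≤ d * (d * N) := Nat.le_mul_of_pos_left _ hd
        nlinarith) c
    rw [← hMdef] at h3
    calc _ ≤ d * (A + (N + A + 2 * (2 + d * N) + N) * M) := by gcongr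
      _ ≤ _ := by
        have h4 : d * (N + A) * M ≤ M ^ 2 := by rw [sq]; gcongr; omega
        have h5 : d * A ≤ d * (M * 1) := by
          have : A ≤ d * (N + A) := by nlinarith
          gcongr; omega
        nlinarith [Nat.zero_le (d * (d * N) * M), Nat.zero_le (d * M)]

theorem eval_eq_zero_of_eq_mul {P Q : ℂ[X]} {T : PowerSeries ℂ} {D B : ℝ} {z : ℂ}
    (hT : ∀ j, ‖PowerSeries.coeff j T‖ ≤ D * B ^ j) (hB : 0 ≤ B) (hz : B * ‖z‖ < 1)
    (hPQ : (P : PowerSeries ℂ) = T * Q) (hQ : Q.eval z = 0) : P.eval z = 0 := by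
  have hpoly : ∀ R : ℂ[X], HasSum (fun j => R.coeff j * z ^ j) (R.eval z) := by
    intro R
    rw [eval_eq_sum_range]
    refine hasSum_sum_of_ne_finset_zero fun j hj => ?_
    rw [coeff_eq_zero_of_natDegree_lt (by simpa [Nat.lt_succ_iff] using hj), zero_mul]
  have h1 : Summable fun j => ‖PowerSeries.coeff j T * z ^ j‖ := by
    refine Summable.of_nonneg_of_le (fun _ => norm_nonneg _) (fun j => ?_)
      ((summable_geometric_of_lt_one (by positivity) hz).mul_left D)
    rw [norm_mul, norm_pow, mul_pow, ← mul_assoc]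
    gcongr
    exact hT j
  have h2 : Summable fun j => ‖Q.coeff j * z ^ j‖ := (hpoly Q).summable.norm
  have h3 := tsum_mul_tsum_eq_tsum_sum_antidiagonal_of_summable_norm h1 h2
  rw [(hpoly Q).tsum_eq, hQ, mul_zero] at h3
  rw [← (hpoly P).tsum_eq, h3]
  refine tsum_congr fun m => ?_
  rw [← coeff_coe, hPQ, PowerSeries.coeff_mul, sum_mul]
  refine sum_congr rfl fun x hx => ?_
  rw [← mem_antidiagonal.mp hx, pow_add, coeff_coe]
  ring

theorem one_le_mul_norm_of_isRoot {H : ℂ[X]} {T : PowerSeries ℂ} {D B : ℝ} {z : ℂ}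
    (hT : ∀ j, ‖PowerSeries.coeff j T‖ ≤ D * B ^ j) (hB : 0 ≤ B) (hH : H ≠ 0)
    (hHT : (derivative H : ℂ[X]) = T * (H : PowerSeries ℂ)) (hz : H.IsRoot z) :
    1 ≤ B * ‖z‖ := by
  by_contra! hlt
  obtain ⟨G, hG, hGz⟩ := exists_eq_pow_rootMultiplicity_mul_and_not_dvd H hH z
  obtain ⟨k, hk⟩ := Nat.exists_eq_succ_of_ne_zero ((rootMultiplicity_pos hH).mpr hz).ne'
  rw [hk] at hG
  have hne : ((((X - C z) ^ k : ℂ[X])) : PowerSeries ℂ) ≠ 0 := by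
    rw [Ne, Polynomial.coe_eq_zero_iff]
    exact pow_ne_zero _ (X_sub_C_ne_zero z)
  have hP : ((((k : ℂ[X]) + 1) * G + (X - C z) * derivative G : ℂ[X]) : PowerSeries ℂ) =
      T * (((X - C z) * G : ℂ[X]) : PowerSeries ℂ) := by
    apply mul_left_cancel₀ hne
    have h1 : derivative H = (X - C z) ^ k *
        ((((k : ℂ[X]) + 1) * G + (X - C z) * derivative G)) := by
      rw [hG]
      simp only [derivative_mul, derivative_X_sub_C_pow]
      simp
      ring
    rw [← Polynomial.coe_mul, ← h1, hHT, hG, pow_succ]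
    simp only [Polynomial.coe_mul]
    ring
  have h2 := eval_eq_zero_of_eq_mul hT hB hlt hP (by simp)
  simp only [eval_add, eval_mul, eval_sub, eval_X, eval_C, sub_self, zero_mul, add_zero,
    eval_natCast, eval_one, mul_eq_zero] at h2
  rcases h2 with h2 | h2
  · exact Nat.cast_add_one_ne_zero k h2
  · exact hGz (dvd_iff_isRoot.mpr h2)

theorem norm_le_of_newton {n : ℕ} (hn : 2 ≤ n) {e S : ℕ → ℂ} {A B : ℝ} (hB : 0 < B) (he0 : e 0 = 1)
    (hen : ∀ m, n ≤ m → e m = 0)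
    (hN : ∀ m : ℕ, ((m : ℂ) + 1) * e (m + 1) = ∑ x ∈ Finset.HasAntidiagonal.antidiagonal m,
      S (x.1 + 1) * e x.2)
    (hS : ∀ r, 0 < r → ‖S (2 * r)‖ ≤ A * B ^ (2 * r)) : ‖S 1‖ ≤ (n - 1) * B := by
  set L : ℂ[X] := ∑ m ∈ range n, C (e m) * X ^ m with hL
  have hLc : ∀ m, L.coeff m = e m := by
    intro m
    simp only [hL, finsetSum_coeff, coeff_C_mul_X_pow, sum_ite_eq, mem_range]
    split_ifs with h
    · rfl
    · rw [hen m (by omega)]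
  set T : PowerSeries ℂ := PowerSeries.mk fun j => S (j + 1) with hTdef
  have hLT : (derivative L : ℂ[X]) = T * (L : PowerSeries ℂ) := by
    ext m
    rw [coeff_coe, coeff_derivative, hLc, PowerSeries.coeff_mul, mul_comm, hN]
    exact sum_congr rfl fun x _ => by simp [hTdef, hLc]
  set H : ℂ[X] := L * L.comp (-X) with hH
  have hLneg : ((L.comp (-X) : ℂ[X]) : PowerSeries ℂ) =
      PowerSeries.evalNegHom (L : PowerSeries ℂ) := by
    ext m
    rw [coeff_coe, PowerSeries.evalNegHom, PowerSeries.coeff_rescale, coeff_coe, ← neg_one_mul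
      (X : ℂ[X]), ← C_1, ← C_neg, comp_C_mul_X_coeff]
    ring
  set U : PowerSeries ℂ := T - PowerSeries.evalNegHom T with hU
  have hHU : (derivative H : ℂ[X]) = U * (H : PowerSeries ℂ) := by
    have h1 : derivative (L.comp (-X)) = - ((derivative L).comp (-X)) := by
      rw [derivative_comp]; simp
    have h2 : (((derivative L).comp (-X) : ℂ[X]) : PowerSeries ℂ) =
        PowerSeries.evalNegHom ((derivative L : ℂ[X]) : PowerSeries ℂ) := by
      ext m
      rw [coeff_coe, PowerSeries.evalNegHom, PowerSeries.coeff_rescale, coeff_coe, ← neg_one_mul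
        (X : ℂ[X]), ← C_1, ← C_neg, comp_C_mul_X_coeff]
      ring
    rw [hH, derivative_mul, h1, Polynomial.coe_add, Polynomial.coe_mul, Polynomial.coe_mul,
      Polynomial.coe_mul, Polynomial.coe_neg, h2, hLT, hLneg, hU, map_mul]
    ring
  have hUb : ∀ j, ‖PowerSeries.coeff j U‖ ≤ (2 * |A| * B) * B ^ j := by
    intro j
    rw [hU, map_sub, PowerSeries.evalNegHom, PowerSeries.coeff_rescale, hTdef, PowerSeries.coeff_mk]
    rcases Nat.even_or_odd j with hj | hj
    · rw [hj.neg_one_pow]; simp; positivity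
    · rw [hj.neg_one_pow]
      obtain ⟨i, rfl⟩ := hj
      have h3 := hS (i + 1) (by omega)
      have h4 : 2 * i + 1 + 1 = 2 * (i + 1) := by ring
      rw [h4, neg_one_mul, sub_neg_eq_add, ← two_mul, norm_mul, Complex.norm_ofNat]
      calc _ ≤ 2 * (|A| * B ^ (2 * (i + 1))) := by
            gcongr
            exact h3.trans (by gcongr; exact le_abs_self A)
        _ = _ := by ring
  have hL0 : L ≠ 0 := fun h => by
    have := hLc 0
    rw [h, he0] at this
    simp at this
  have hLneg0 : L.comp (-X) ≠ 0 := fun h => by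
    have := congrArg (eval 0) h
    simp [eval_comp, ← coeff_zero_eq_eval_zero, hLc, he0] at this
  set R : ℂ[X] := ∑ m ∈ range n, C (e m) * X ^ (n - 1 - m) with hR
  have hRc : ∀ m, m < n → R.coeff (n - 1 - m) = e m := by
    intro m hm
    simp only [hR, finsetSum_coeff, coeff_C_mul_X_pow]
    rw [sum_eq_single m]
    · simp
    · intro b hb hbm
      rw [if_neg]
      have := mem_range.mp hb
      omega
    · intro h; exact absurd (mem_range.mpr hm) h
  have hRd : R.natDegree ≤ n - 1 := natDegree_sum_le_of_forall_le _ _ fun m _ =>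
    (natDegree_C_mul_X_pow_le _ _).trans (by omega)
  have hRtop : R.coeff (n - 1) = 1 := by simpa [he0] using hRc 0 (by omega)
  have hRmonic : R.Monic := monic_of_natDegree_le_of_coeff_eq_one _ hRd hRtop
  have hRdeg : R.natDegree = n - 1 := le_antisymm hRd (le_natDegree_of_ne_zero (by simp [hRtop]))
  have hroots : ∀ w ∈ R.roots, ‖w‖ ≤ B := by
    intro w hw
    rcases eq_or_ne w 0 with rfl | hw0
    · simpa using hB.le
    have h5 : L.eval w⁻¹ = 0 := by
      have h6 : R.eval w = w ^ (n - 1) * L.eval w⁻¹ := by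
        rw [hR, hL, eval_finsetSum, eval_finsetSum, mul_sum]
        refine sum_congr rfl fun m hm => ?_
        have := mem_range.mp hm
        simp only [eval_mul, eval_C, eval_pow, eval_X]
        rw [pow_sub₀ _ hw0 (by omega), inv_pow]
        ring
      rw [(isRoot_of_mem_roots hw).eq_zero] at h6
      exact (mul_eq_zero.mp h6.symm).resolve_left (pow_ne_zero _ hw0)
    have h7 := one_le_mul_norm_of_isRoot (z := w⁻¹) hUb hB.le (mul_ne_zero hL0 hLneg0) hHU
      (by rw [IsRoot.def, eval_mul, h5, zero_mul])
    rw [norm_inv, ← div_eq_mul_inv, one_le_div (norm_pos_iff.mpr hw0)] at h7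
    exact h7
  have hS1 : S 1 = -R.roots.sum := by
    have h8 := hN 0
    simp [he0] at h8
    rw [← h8, ← hRc 1 (by omega)]
    have h9 := (IsAlgClosed.splits R).nextCoeff_eq_neg_sum_roots_of_monic hRmonic
    rw [← h9, nextCoeff_of_natDegree_pos (by omega), hRdeg]
  rw [hS1, norm_neg]
  refine (norm_multiset_sum_le _).trans ((Multiset.sum_le_card_nsmul _ B ?_).trans ?_)
  · intro x hx
    obtain ⟨w, hw, rfl⟩ := Multiset.mem_map.mp hx
    exact hroots w hw
  · rw [Multiset.card_map, ← (IsAlgClosed.splits R).natDegree_eq_card_roots, hRdeg, nsmul_eq_mul,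
      Nat.cast_sub (by omega), Nat.cast_one]

theorem powerFree_prod {K ι : Type*} [Field K] [Fintype ι] {a : ι → K}
    (ha : Function.Injective a) {b : ι → ℕ} {d : ℕ}
    (hd : ∀ e, (∀ i, d ∣ e * b i) → d ∣ e) : PowerFree (∏ i, (X + C (a i)) ^ b i) d := by
  classical
  intro e u v c hu hv hc h
  refine hd e fun i => ?_
  have hne : ∀ j, (X + C (a j)) ≠ 0 := fun j => X_add_C_ne_zero _
  have hprod : ∏ i, (X + C (a i)) ^ b i ≠ 0 := prod_ne_zero_iff.mpr fun j _ => pow_ne_zero _ (hne j)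
  have hpow : ∀ (w : K[X]) (k : ℕ), rootMultiplicity (-a i) (w ^ k) =
      k * rootMultiplicity (-a i) w := by
    intro w k
    rw [← count_roots, ← count_roots, roots_pow, Multiset.count_nsmul]
  have h1 := congrArg (rootMultiplicity (-a i)) h
  rw [rootMultiplicity_mul (mul_ne_zero (pow_ne_zero _ hu) (pow_ne_zero _ hprod)),
    rootMultiplicity_mul (mul_ne_zero (C_ne_zero.mpr hc) (pow_ne_zero _ hv)),
    hpow, hpow, hpow, rootMultiplicity_C, zero_add] at h1
  have h2 : rootMultiplicity (-a i) (∏ i, (X + C (a i)) ^ b i) = b i := by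
    rw [← mul_prod_erase univ _ (mem_univ i)] at hprod ⊢
    rw [rootMultiplicity_mul hprod, rootMultiplicity_eq_zero (p := ∏ j ∈ univ.erase i, _)]
    · have h3 := rootMultiplicity_X_sub_C_pow (-a i) (b i)
      rwa [C_neg, sub_neg_eq_add] at h3
    · rw [IsRoot.def, eval_prod]
      refine prod_ne_zero_iff.mpr fun j hj => ?_
      rw [eval_pow, eval_add, eval_X, eval_C, neg_add_eq_sub]
      exact pow_ne_zero _ (sub_ne_zero.mpr (ha.ne (ne_of_mem_erase hj)))
  rw [h2] at h1
  exact (Nat.dvd_add_right (dvd_mul_right d _)).mp (h1 ▸ dvd_mul_right d _)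

theorem norm_algebraMap_sub {F K : Type*} [Field F] [Field K] [Algebra F K] [FiniteDimensional F K]
    [Algebra.IsSeparable F K] (x : K) (c : F) : Algebra.norm F (algebraMap F K c - x) =
      (minpoly F x).eval c ^ (Module.finrank F K / (minpoly F x).natDegree) := by
  set z := x - algebraMap F K c with hz
  have hzi : IsIntegral F z := Algebra.IsIntegral.isIntegral z
  have hmin : minpoly F z = (minpoly F x).comp (X + C c) := minpoly.sub_algebraMap x c
  have hdeg : (minpoly F z).natDegree = (minpoly F x).natDegree := by
    rw [hmin, natDegree_comp, natDegree_X_add_C, mul_one]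
  have hfin : Module.finrank F (IntermediateField.adjoin F {z}) = (minpoly F x).natDegree := by
    rw [IntermediateField.adjoin.finrank hzi, hdeg]
  have hmul := Module.finrank_mul_finrank F (IntermediateField.adjoin F {z}) K
  rw [hfin] at hmul
  have hpos : 0 < (minpoly F x).natDegree :=
    minpoly.natDegree_pos (Algebra.IsIntegral.isIntegral x)
  have hquot : Module.finrank F K / (minpoly F x).natDegree =
      Module.finrank (IntermediateField.adjoin F {z}) K := by
    rw [← hmul, Nat.mul_div_cancel_left _ hpos]
  have hgen : Algebra.norm F (IntermediateField.AdjoinSimple.gen F z) =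
      (-1) ^ (minpoly F x).natDegree * (minpoly F x).eval c := by
    have h := Algebra.PowerBasis.norm_gen_eq_coeff_zero_minpoly
      (IntermediateField.adjoin.powerBasis hzi)
    rw [IntermediateField.adjoin.powerBasis_gen, IntermediateField.adjoin.powerBasis_dim,
      IntermediateField.minpoly_gen, hdeg, hmin, coeff_zero_eq_eval_zero, eval_comp] at h
    simpa using h
  have hneg : algebraMap F K c - x = algebraMap F K (-1) * z := by
    rw [hz, map_neg, map_one]; ring
  rw [hneg, map_mul, Algebra.norm_algebraMap, Algebra.norm_eq_norm_adjoin F z, hgen, hquot, mul_pow,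
    ← pow_mul, hmul, ← mul_assoc, ← mul_pow]
  norm_num

theorem finite_monic_natDegree (F : Type*) [Field F] [Finite F] (m : ℕ) :
    {h : F[X] | h.Monic ∧ h.natDegree = m}.Finite := by
  have : Finite (degreeLT F m) := .of_equiv _ (degreeLTEquiv F m).toEquiv.symm
  exact Set.finite_coe_iff.mp (.of_equiv _ (monicEquivDegreeLT (R := F) m).symm)

/-- The finset of monic polynomials of degree `m` over a finite field. -/
noncomputable def monics (F : Type*) [Field F] [Finite F] (m : ℕ) : Finset F[X] :=
  (finite_monic_natDegree F m).toFinset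

open Classical in
/-- The finset of monic irreducible polynomials of degree `m` over a finite field. -/
noncomputable def monicIrreducibles (F : Type*) [Field F] [Finite F] (m : ℕ) : Finset F[X] :=
  (monics F m).filter Irreducible

theorem mem_monics {F : Type*} [Field F] [Finite F] {m : ℕ} {h : F[X]} :
    h ∈ monics F m ↔ h.Monic ∧ h.natDegree = m := by simp [monics]

theorem mem_monicIrreducibles {F : Type*} [Field F] [Finite F] {m : ℕ} {h : F[X]} :
    h ∈ monicIrreducibles F m ↔ h.Monic ∧ h.natDegree = m ∧ Irreducible h := by
  simp [monicIrreducibles, mem_monics, and_assoc]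

open Classical in
theorem natDegree_eq_sum_pow_dvd {F : Type*} [Field F] [Finite F] {h : F[X]} (hh : h.Monic) :
    h.natDegree = ∑ d ∈ Icc 1 h.natDegree, ∑ k ∈ Icc 1 h.natDegree,
      ∑ P ∈ monicIrreducibles F d, if P ^ k ∣ h then d else 0 := by
  have h0 : h ≠ 0 := hh.ne_zero
  set s := UniqueFactorizationMonoid.normalizedFactors h with hs
  have hcount : ∀ P : F[X], Irreducible P → P.Monic → ∀ k, P ^ k ∣ h ↔ k ≤ s.count P := by
    intro P hP hPm k
    rw [pow_dvd_iff_le_emultiplicity,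
      UniqueFactorizationMonoid.emultiplicity_eq_count_normalizedFactors hP h0,
      hPm.normalize_eq_self, Nat.cast_le]
  have hprod : s.prod = h := by
    rw [hs, UniqueFactorizationMonoid.prod_normalizedFactors_eq h0, hh.normalize_eq_self]
  have hmem : ∀ P ∈ s, Irreducible P ∧ P.Monic ∧ P ∣ h := fun P hP =>
    ⟨UniqueFactorizationMonoid.irreducible_of_normalized_factor P hP, by
      have := UniqueFactorizationMonoid.normalize_normalized_factor P hP
      rw [← this]
      exact monic_normalize (UniqueFactorizationMonoid.irreducible_of_normalized_factor P
        hP).ne_zero,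
      UniqueFactorizationMonoid.dvd_of_mem_normalizedFactors hP⟩
  have hdegle : ∀ P : F[X], ∀ k, P ^ k ∣ h → k * P.natDegree ≤ h.natDegree := by
    intro P k hP
    rw [← natDegree_pow]
    exact natDegree_le_of_dvd hP h0
  have hinner : ∀ d ∈ Icc 1 h.natDegree, (∑ k ∈ Icc 1 h.natDegree,
      ∑ P ∈ monicIrreducibles F d, if P ^ k ∣ h then d else 0) =
      ∑ P ∈ s.toFinset.filter (fun P => P.natDegree = d), s.count P * P.natDegree := by
    intro d hd
    rw [mem_Icc] at hd
    rw [sum_comm]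
    have hsub : s.toFinset.filter (fun P => P.natDegree = d) ⊆ monicIrreducibles F d := by
      intro P hP
      rw [mem_filter, Multiset.mem_toFinset] at hP
      exact mem_monicIrreducibles.mpr ⟨(hmem P hP.1).2.1, hP.2, (hmem P hP.1).1⟩
    rw [sum_subset hsub (f := fun P => s.count P * P.natDegree)]
    · refine sum_congr rfl fun P hP => ?_
      obtain ⟨hPm, hPd, hPi⟩ := mem_monicIrreducibles.mp hP
      have hle : s.count P ≤ h.natDegree := by
        have := hdegle P _ ((hcount P hPi hPm _).mpr le_rfl)
        rw [hPd] at this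
        nlinarith
      rw [← sum_filter, sum_const, smul_eq_mul, hPd]
      congr 1
      have : (Icc 1 h.natDegree).filter (fun k => P ^ k ∣ h) = Icc 1 (s.count P) := by
        ext k
        rw [mem_filter, mem_Icc, mem_Icc, hcount P hPi hPm]
        omega
      rw [this, Nat.card_Icc, Nat.add_sub_cancel]
    · intro P hP hPn
      have : P ∉ s := fun hmem' => hPn (mem_filter.mpr
        ⟨Multiset.mem_toFinset.mpr hmem', (mem_monicIrreducibles.mp hP).2.1⟩)
      rw [Multiset.count_eq_zero_of_notMem this, zero_mul]
  rw [sum_congr rfl hinner, sum_fiberwise_of_maps_to]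
  · conv_lhs => rw [← hprod, natDegree_multiset_prod _
      (UniqueFactorizationMonoid.zero_notMem_normalizedFactors _)]
    rw [Finset.sum_multiset_map_count]
    rfl
  · intro P hP
    rw [Multiset.mem_toFinset] at hP
    obtain ⟨h1, h2, h3⟩ := hmem P hP
    exact mem_Icc.mpr ⟨h1.natDegree_pos, natDegree_le_of_dvd h3 h0⟩

/-- The sum of `χ` over the monic polynomials of degree `m`. -/
noncomputable def monicSum {F : Type*} [Field F] [Finite F] (χ : F[X] →* ℂ) (m : ℕ) : ℂ :=
  ∑ h ∈ monics F m, χ h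

/-- The weighted sum of `χ` over the powers of degree `j` of monic irreducible polynomials. -/
noncomputable def irreducibleSum {F : Type*} [Field F] [Finite F] (χ : F[X] →* ℂ) (j : ℕ) : ℂ :=
  ∑ d ∈ j.divisors, ∑ P ∈ monicIrreducibles F d, (d : ℂ) * χ P ^ (j / d)

open Classical in
theorem sum_monics_pow_dvd {F : Type*} [Field F] [Finite F] (χ : F[X] →* ℂ) {P : F[X]}
    (hP : P.Monic) (k m : ℕ) : ∑ h ∈ monics F m, (if P ^ k ∣ h then χ h else 0) =
      if P.natDegree * k ≤ m then χ P ^ k * monicSum χ (m - P.natDegree * k) else 0 := by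
  have hPk : (P ^ k).Monic := hP.pow k
  have hdeg : (P ^ k).natDegree = P.natDegree * k := by rw [natDegree_pow, mul_comm]
  rw [← sum_filter]
  split_ifs with hle
  · rw [monicSum, mul_sum]
    symm
    refine sum_bij (fun g _ => P ^ k * g) ?_ ?_ ?_ ?_
    · intro g hg
      rw [mem_monics] at hg
      rw [mem_filter, mem_monics]
      refine ⟨⟨hPk.mul hg.1, ?_⟩, dvd_mul_right _ _⟩
      rw [hPk.natDegree_mul hg.1, hdeg, hg.2]
      omega
    · intro g _ g' _ h
      exact mul_left_cancel₀ hPk.ne_zero h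
    · intro h hh
      rw [mem_filter, mem_monics] at hh
      obtain ⟨⟨h1, h2⟩, g, rfl⟩ := hh
      have hg : g.Monic := hPk.of_mul_monic_left h1
      rw [hPk.natDegree_mul hg, hdeg] at h2
      exact ⟨g, mem_monics.mpr ⟨hg, by omega⟩, rfl⟩
    · intro g _
      rw [map_mul, map_pow]
  · refine sum_eq_zero fun h hh => ?_
    rw [mem_filter, mem_monics] at hh
    have := natDegree_le_of_dvd hh.2 hh.1.1.ne_zero
    omega

open Classical in
theorem newton_monicSum {F : Type*} [Field F] [Finite F] (χ : F[X] →* ℂ) (m : ℕ) :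
    (m : ℂ) * monicSum χ m = ∑ j ∈ Icc 1 m, irreducibleSum χ j * monicSum χ (m - j) := by
  have hleft : (m : ℂ) * monicSum χ m = ∑ d ∈ Icc 1 m, ∑ k ∈ Icc 1 m,
      ∑ P ∈ monicIrreducibles F d,
        if d * k ≤ m then d * χ P ^ k * monicSum χ (m - d * k) else 0 := by
    have h1 : (m : ℂ) * monicSum χ m = ∑ h ∈ monics F m, ∑ d ∈ Icc 1 m, ∑ k ∈ Icc 1 m,
        ∑ P ∈ monicIrreducibles F d, (d : ℂ) * (if P ^ k ∣ h then χ h else 0) := by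
      rw [monicSum, mul_sum]
      refine sum_congr rfl fun h hh => ?_
      obtain ⟨h1, rfl⟩ := mem_monics.mp hh
      conv_lhs => rw [natDegree_eq_sum_pow_dvd h1]
      push_cast
      simp only [sum_mul]
      refine sum_congr rfl fun d _ => sum_congr rfl fun k _ => sum_congr rfl fun P _ => ?_
      split_ifs <;> simp
    rw [h1, sum_comm]
    refine sum_congr rfl fun d _ => ?_
    rw [sum_comm]
    refine sum_congr rfl fun k _ => ?_
    rw [sum_comm]
    refine sum_congr rfl fun P hP => ?_
    obtain ⟨hPm, hPd, -⟩ := mem_monicIrreducibles.mp hP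
    rw [← mul_sum, sum_monics_pow_dvd χ hPm, hPd]
    split_ifs <;> ring
  have hright : ∀ j ∈ Icc 1 m, irreducibleSum χ j * monicSum χ (m - j) =
      ∑ d ∈ Icc 1 m, ∑ k ∈ Icc 1 m, if d * k = j then
        (∑ P ∈ monicIrreducibles F d, d * χ P ^ k) * monicSum χ (m - j) else 0 := by
    intro j hj
    rw [mem_Icc] at hj
    have hdiv : j.divisors = (Icc 1 m).filter (fun d => d ∣ j) := by
      ext d
      rw [Nat.mem_divisors, mem_filter, mem_Icc]
      constructor
      · rintro ⟨h1, h2⟩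
        exact ⟨⟨Nat.pos_of_dvd_of_pos h1 hj.1, (Nat.le_of_dvd hj.1 h1).trans hj.2⟩, h1⟩
      · rintro ⟨-, h1⟩
        exact ⟨h1, by omega⟩
    rw [irreducibleSum, sum_mul, hdiv, sum_filter]
    refine sum_congr rfl fun d hd => ?_
    rw [mem_Icc] at hd
    split_ifs with hdj
    · obtain ⟨k, rfl⟩ := hdj
      rw [Nat.mul_div_cancel_left _ hd.1, sum_eq_single k]
      · simp
      · intro k' _ hk'
        rw [if_neg fun h => hk' (Nat.eq_of_mul_eq_mul_left hd.1 h)]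
      · intro hk
        exact absurd (mem_Icc.mpr ⟨Nat.pos_of_mul_pos_left hj.1,
          (Nat.le_mul_of_pos_left k hd.1).trans hj.2⟩) hk
    · exact (sum_eq_zero fun k _ => if_neg fun h => hdj ⟨k, h.symm⟩).symm
  rw [hleft, sum_congr rfl hright]
  symm
  rw [sum_comm]
  refine sum_congr rfl fun d hd => ?_
  rw [sum_comm]
  refine sum_congr rfl fun k hk => ?_
  rw [mem_Icc] at hd hk
  rw [sum_ite_eq]
  have : 1 ≤ d * k := Nat.mul_pos hd.1 hk.1
  simp only [mem_Icc, this, true_and]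
  split_ifs
  · rw [sum_mul]
  · simp

open Classical in
theorem card_filter_minpoly_eq {F K : Type*} [Field F] [Finite F] [Field K] [Fintype K]
    [Algebra F K]
    {P : F[X]} (hPm : P.Monic) (hP : Irreducible P) (hdvd : P.natDegree ∣ Module.finrank F K) :
    #{x : K | minpoly F x = P} = P.natDegree := by
  have hcard : Nat.card F ^ Module.finrank F K = Fintype.card K := by
    rw [← Nat.card_eq_fintype_card, ← Module.natCard_eq_pow_finrank]
  have h1 : P ∣ X ^ Fintype.card K - X := by
    rw [← hcard]
    exact hP.natDegree_dvd_iff_dvd_X_pow_card_pow_sub_X.mp hdvd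
  have h2 := (FiniteField.isSplittingField_sub K F).splits
  have h3 : (P.map (algebraMap F K)).Splits := by
    refine h2.of_dvd ?_ (Polynomial.map_dvd _ h1)
    exact Polynomial.map_ne_zero (FiniteField.X_pow_card_sub_X_ne_zero F Fintype.one_lt_card)
  rw [← card_rootSet_eq_natDegree (K := K) (PerfectField.separable_of_irreducible hP) h3,
    ← Set.toFinset_card]
  congr 1
  ext x
  rw [mem_filter_univ, Set.mem_toFinset, mem_rootSet_of_ne hPm.ne_zero]
  constructor
  · rintro rfl
    exact minpoly.aeval F x
  · intro hx
    exact (minpoly.eq_of_irreducible_of_monic hP hx hPm).symm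

theorem irreducibleSum_finrank {F K : Type*} [Field F] [Finite F] [Field K] [Fintype K]
    [Algebra F K]
    (χ : F[X] →* ℂ) : irreducibleSum χ (Module.finrank F K) =
      ∑ x : K, χ (minpoly F x) ^ (Module.finrank F K / (minpoly F x).natDegree) := by
  classical
  have hx : ∀ x : K, χ (minpoly F x) ^ (Module.finrank F K / (minpoly F x).natDegree) =
      ∑ d ∈ (Module.finrank F K).divisors, ∑ P ∈ monicIrreducibles F d,
        if minpoly F x = P then χ P ^ (Module.finrank F K / d) else 0 := by
    intro x
    have hxint : IsIntegral F x := Algebra.IsIntegral.isIntegral x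
    rw [sum_eq_single (minpoly F x).natDegree]
    · rw [sum_ite_eq, if_pos (mem_monicIrreducibles.mpr
        ⟨minpoly.monic hxint, rfl, minpoly.irreducible hxint⟩)]
    · intro d _ hd
      refine sum_eq_zero fun P hP => if_neg ?_
      rintro rfl
      exact hd (mem_monicIrreducibles.mp hP).2.1.symm
    · intro h
      exact absurd (Nat.mem_divisors.mpr ⟨minpoly.degree_dvd hxint, Module.finrank_pos.ne'⟩) h
  rw [sum_congr rfl fun x _ => hx x, sum_comm, irreducibleSum]
  refine sum_congr rfl fun d hd => ?_
  rw [sum_comm]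
  refine sum_congr rfl fun P hP => ?_
  obtain ⟨hPm, hPd, hPi⟩ := mem_monicIrreducibles.mp hP
  rw [← sum_filter, sum_const, card_filter_minpoly_eq hPm hPi
    (hPd ▸ (Nat.mem_divisors.mp hd).1), hPd, nsmul_eq_mul]

/-- The multiplicative function on polynomials given by a product of multiplicative characters
evaluated at the values of the polynomial. -/
noncomputable def evalChar {F ι : Type*} [Field F] [Fintype ι] (ψ : ι → MulChar F ℂ) (a : ι → F) :
    F[X] →* ℂ where
  toFun h := ∏ i, ψ i (h.eval (a i))
  map_one' := by simp
  map_mul' g h := by simp [prod_mul_distrib]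

theorem evalChar_apply {F ι : Type*} [Field F] [Fintype ι] (ψ : ι → MulChar F ℂ) (a : ι → F)
    (h : F[X]) : evalChar ψ a h = ∏ i, ψ i (h.eval (a i)) := rfl

theorem irreducibleSum_evalChar {F K ι : Type*} [Field F] [Finite F] [Field K] [Fintype K]
    [Algebra F K] [Fintype ι] (ψ : ι → MulChar F ℂ) (a : ι → F) :
    irreducibleSum (evalChar ψ a) (Module.finrank F K) =
      ∑ x : K, ∏ i, ψ i (Algebra.norm F (x + algebraMap F K (a i))) := by
  rw [irreducibleSum_finrank (K := K), ← Equiv.sum_comp (Equiv.neg K)]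
  refine sum_congr rfl fun x _ => ?_
  rw [evalChar_apply, ← prod_pow]
  refine prod_congr rfl fun i _ => ?_
  rw [Equiv.neg_apply, ← map_pow, ← norm_algebraMap_sub, sub_neg_eq_add, add_comm]

theorem monicSum_evalChar_eq_zero {F ι : Type*} [Field F] [Finite F] [Fintype ι]
    {ψ : ι → MulChar F ℂ} {a : ι → F} (ha : Function.Injective a) (hψ : ∃ i, ψ i ≠ 1) {m : ℕ}
    (hm : Fintype.card ι ≤ m) : monicSum (evalChar ψ a) m = 0 := by
  classical
  obtain ⟨i, hi⟩ := hψ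
  obtain ⟨u, hu⟩ := MulChar.ne_one_iff.mp hi
  set L := Lagrange.basis univ a i with hL
  have hL1 : L.eval (a i) = 1 := Lagrange.eval_basis_self ha.injOn (mem_univ i)
  have hL0 : ∀ j, j ≠ i → L.eval (a j) = 0 := fun j hj =>
    Lagrange.eval_basis_of_ne hj.symm (mem_univ j)
  have hcard : 0 < Fintype.card ι := Fintype.card_pos_iff.mpr ⟨i⟩
  have hLd : L.natDegree < m := by
    rw [hL, Lagrange.natDegree_basis ha.injOn (mem_univ i), card_univ]
    omega
  have hmem : ∀ (c : F) (h : F[X]), h ∈ monics F m →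
      h + C (c * h.eval (a i)) * L ∈ monics F m := by
    intro c h hh
    rw [mem_monics] at hh ⊢
    have hlt : (C (c * h.eval (a i)) * L).degree < h.degree := by
      rw [degree_eq_natDegree hh.1.ne_zero, hh.2]
      exact (degree_le_of_natDegree_le (natDegree_C_mul_le _ _)).trans_lt (by exact_mod_cast hLd)
    exact ⟨hh.1.add_of_left hlt, by rw [natDegree_add_eq_left_of_degree_lt hlt, hh.2]⟩
  have hu0 : (u : F) ≠ 0 := u.ne_zero
  have key : ψ i u * monicSum (evalChar ψ a) m = monicSum (evalChar ψ a) m := by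
    rw [monicSum, mul_sum]
    refine sum_bij' (fun h _ => h + C (((u : F) - 1) * h.eval (a i)) * L)
      (fun h _ => h + C (((u : F)⁻¹ - 1) * h.eval (a i)) * L)
      (fun h hh => hmem _ h hh) (fun h hh => hmem _ h hh) ?_ ?_ ?_
    · intro h _
      rw [add_assoc, ← add_mul, ← C_add]
      simp only [eval_add, eval_mul, eval_C, hL1]
      convert add_zero h
      rw [mul_eq_zero]
      left
      rw [C_eq_zero]
      field_simp
      ring
    · intro h _
      rw [add_assoc, ← add_mul, ← C_add]
      simp only [eval_add, eval_mul, eval_C, hL1]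
      convert add_zero h
      rw [mul_eq_zero]
      left
      rw [C_eq_zero]
      field_simp
      ring
    · intro h _
      rw [evalChar_apply, evalChar_apply, ← mul_prod_erase univ _ (mem_univ i),
        ← mul_prod_erase univ _ (mem_univ i), ← mul_assoc, ← map_mul]
      congr 1
      · simp only [eval_add, eval_mul, eval_C, hL1]
        congr 1
        ring
      · refine prod_congr rfl fun j hj => ?_
        simp only [eval_add, eval_mul, eval_C, hL0 j (ne_of_mem_erase hj), mul_zero, add_zero]
  by_contra h
  exact hu (mul_eq_right₀ h |>.mp key)

theorem monicSum_zero {F : Type*} [Field F] [Finite F] (χ : F[X] →* ℂ) : monicSum χ 0 = 1 := by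
  have : monics F 0 = {1} := by
    ext h
    rw [mem_monics, mem_singleton]
    constructor
    · rintro ⟨h1, h2⟩
      exact h1.natDegree_eq_zero.mp h2
    · rintro rfl
      simp
  rw [monicSum, this, sum_singleton, map_one]

theorem norm_sum_comp_le_of_card_le {α β : Type*} [DecidableEq β] {G : Finset α} {c : α → β}
    {μ : Finset β} {θ : β → ℂ} (hθ : ∀ y ∈ μ, ‖θ y‖ ≤ 1) (hsum : ∑ y ∈ μ, θ y = 0)
    (hc : ∀ x ∈ G, c x ∈ μ) {d Y Z : ℕ} (hd : 0 < d) (hμ : #μ ≤ d)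
    (hY : ∀ y ∈ μ, d * #{x ∈ G | c x = y} ≤ Y) (hZ : Y ≤ #G + Z) :
    ‖∑ x ∈ G, θ (c x)‖ ≤ Z := by
  have h1 : ∑ x ∈ G, θ (c x) = ∑ y ∈ μ, (#{x ∈ G | c x = y} : ℂ) * θ y := by
    rw [← sum_fiberwise_of_maps_to hc]
    refine sum_congr rfl fun y _ => ?_
    rw [sum_congr rfl fun x hx => by rw [(mem_filter.mp hx).2], sum_const, nsmul_eq_mul]
  have h2 : (d : ℂ) * ∑ x ∈ G, θ (c x) =
      -∑ y ∈ μ, ((Y : ℂ) - d * #{x ∈ G | c x = y}) * θ y := by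
    simp only [sub_mul, sum_sub_distrib]
    rw [← mul_sum, hsum, h1, mul_sum]
    simp [mul_assoc]
  have h3 : ‖∑ y ∈ μ, ((Y : ℂ) - d * #{x ∈ G | c x = y}) * θ y‖ ≤
      ∑ y ∈ μ, ((Y : ℝ) - d * #{x ∈ G | c x = y}) := by
    refine norm_sum_le_of_le _ fun y hy => ?_
    have h0 : (0 : ℝ) ≤ (Y : ℝ) - d * #{x ∈ G | c x = y} := by
      rw [sub_nonneg]
      exact_mod_cast hY y hy
    have h4 : ((Y : ℂ) - d * #{x ∈ G | c x = y}) =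
        (((Y : ℝ) - d * #{x ∈ G | c x = y} : ℝ) : ℂ) := by push_cast; rfl
    rw [norm_mul, h4, Complex.norm_real, Real.norm_of_nonneg h0]
    exact mul_le_of_le_one_right h0 (hθ y hy)
  have h5 : ∑ y ∈ μ, ((Y : ℝ) - d * #{x ∈ G | c x = y}) = #μ * Y - d * #G := by
    rw [sum_sub_distrib, sum_const, nsmul_eq_mul, ← mul_sum, card_eq_sum_card_fiberwise hc]
    push_cast
    rfl
  have h6 : (d : ℝ) * ‖∑ x ∈ G, θ (c x)‖ ≤ d * Z := by
    have h7 : (#μ : ℝ) * Y ≤ d * Y := by gcongr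
    have h8 : (d : ℝ) * Y ≤ d * (#G + Z) := by
      gcongr
      exact_mod_cast hZ
    calc (d : ℝ) * ‖∑ x ∈ G, θ (c x)‖ = ‖(d : ℂ) * ∑ x ∈ G, θ (c x)‖ := by simp
      _ ≤ #μ * Y - d * #G := by rw [h2, norm_neg]; exact h3.trans h5.le
      _ ≤ _ := by linarith
  exact le_of_mul_le_mul_left h6 (by exact_mod_cast hd)

theorem norm_sum_mulChar_le_of_even {F ι : Type*} [Field F] [Fintype F] [Fintype ι]
    {ψ : ι → MulChar F ℂ} {a : ι → F} (ha : Function.Injective a) (hψ : ∃ i, ψ i ≠ 1)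
    (hι : 2 ≤ Fintype.card ι) {A : ℝ}
    (hA : ∀ r, 0 < r → ∀ (K : Type) [Field K] [Fintype K] [Algebra F K],
      Module.finrank F K = 2 * r →
      ‖∑ x : K, ∏ i, ψ i (Algebra.norm F (x + algebraMap F K (a i)))‖ ≤
        A * √(Fintype.card F) ^ (2 * r)) :
    ‖∑ x, ∏ i, ψ i (x + a i)‖ ≤ (Fintype.card ι - 1) * √(Fintype.card F) := by
  have h1 : irreducibleSum (evalChar ψ a) 1 = ∑ x, ∏ i, ψ i (x + a i) := by
    have := irreducibleSum_evalChar (K := F) ψ a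
    rw [Module.finrank_self] at this
    rw [this]
    refine sum_congr rfl fun x _ => prod_congr rfl fun i _ => ?_
    rw [Algebra.norm_self]
    rfl
  rw [← h1]
  refine norm_le_of_newton (A := A) hι (e := monicSum (evalChar ψ a))
    (Real.sqrt_pos.mpr (by exact_mod_cast Fintype.card_pos)) (monicSum_zero _)
    (fun m hm => monicSum_evalChar_eq_zero ha hψ hm) (fun m => ?_) fun r hr => ?_
  · have h2 := newton_monicSum (evalChar ψ a) (m + 1)
    push_cast at h2
    rw [h2, Finset.Nat.sum_antidiagonal_eq_sum_range_succ (fun i j =>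
      irreducibleSum (evalChar ψ a) (i + 1) * monicSum (evalChar ψ a) j), range_eq_Ico,
      ← Finset.Ico_add_one_right_eq_Icc, ← sum_Ico_add' _ 0 (m + 1) 1]
    exact sum_congr rfl fun k _ => by rw [Nat.add_sub_add_right]
  · obtain ⟨p, hp⟩ := CharP.exists F
    have : Fact p.Prime := ⟨CharP.char_is_prime F p⟩
    have : NeZero (2 * r) := ⟨by omega⟩
    have : Fintype (FiniteField.Extension F p (2 * r)) := Fintype.ofFinite _
    have h3 := FiniteField.finrank_extension F p (2 * r)
    have h4 := hA r hr (FiniteField.Extension F p (2 * r)) h3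
    rwa [← irreducibleSum_evalChar, h3] at h4

theorem exists_pow_eq_one_mulChar_ne_one {F : Type*} [Field F] [Fintype F] {θ : MulChar F ℂ}
    (hθ : orderOf θ = Fintype.card F - 1) {d D : ℕ} (hd : 1 < d)
    (hdD : d * D = Fintype.card F - 1) :
    ∃ g : F, g ^ d = 1 ∧ θ g ≠ 1 := by
  classical
  obtain ⟨u, hu⟩ := IsCyclic.exists_monoid_generator (α := Fˣ)
  have hD : 0 < D := by
    rcases Nat.eq_zero_or_pos D with rfl | h
    · have := Fintype.one_lt_card (α := F)
      omega
    · exact h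
  refine ⟨((u ^ D : Fˣ) : F), ?_, fun h => ?_⟩
  · rw [← Units.val_pow_eq_pow_val, ← pow_mul, mul_comm, hdD, ← Fintype.card_units, pow_card_eq_one,
      Units.val_one]
  · have h1 : θ ^ D = 1 := by
      rw [MulChar.eq_one_iff]
      intro v
      obtain ⟨k, rfl⟩ := Submonoid.mem_powers_iff _ _ |>.mp (hu v)
      rw [MulChar.pow_apply_coe, Units.val_pow_eq_pow_val, map_pow, ← pow_mul, mul_comm, pow_mul,
        ← map_pow, ← Units.val_pow_eq_pow_val, h, one_pow]
    have h2 := Nat.le_of_dvd hD (orderOf_dvd_of_pow_eq_one h1)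
    rw [hθ, ← hdD] at h2
    nlinarith

theorem exists_norm_sum_le {F ι : Type*} [Field F] [Fintype F] [Fintype ι]
    {θ : MulChar F ℂ} (hθ : orderOf θ = Fintype.card F - 1) {a : ι → F}
    (ha : Function.Injective a) {b : ι → ℕ} (hb : ∃ i, ¬ (Fintype.card F - 1) ∣ b i) :
    ∃ A : ℝ, ∀ r, 0 < r → ∀ (K : Type) [Field K] [Fintype K] [Algebra F K],
      Module.finrank F K = 2 * r →
      ‖∑ x : K, ∏ i, (θ ^ b i) (Algebra.norm F (x + algebraMap F K (a i)))‖ ≤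
        A * √(Fintype.card F) ^ (2 * r) := by
  classical
  set q := Fintype.card F with hq
  have hq1 : 1 < q := Fintype.one_lt_card
  obtain ⟨p, hp⟩ := CharP.exists F
  have hpp : Fact p.Prime := ⟨CharP.char_is_prime F p⟩
  obtain ⟨s, -, hqs⟩ := FiniteField.card F p
  obtain ⟨D, hD⟩ : ∃ D, D = Nat.gcd (q - 1) (univ.gcd b) := ⟨_, rfl⟩
  have hDq : D ∣ q - 1 := hD ▸ Nat.gcd_dvd_left _ _
  have hDb : ∀ i, D ∣ b i := fun i => hD ▸ (Nat.gcd_dvd_right _ _).trans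
    (Finset.gcd_dvd (mem_univ i))
  have hD0 : 0 < D := Nat.pos_of_dvd_of_pos hDq (by omega)
  obtain ⟨d, hd⟩ := hDq
  choose β hβ using hDb
  have hd1 : 1 < d := by
    have hd0 : d ≠ 0 := by rintro rfl; omega
    have hd1 : d ≠ 1 := by
      rintro rfl
      obtain ⟨i, hi⟩ := hb
      rw [hd, mul_one] at hi
      exact hi ⟨_, hβ i⟩
    omega
  have hfree : ∀ e, (∀ i, d ∣ e * β i) → d ∣ e := by
    intro e he
    have h1 : q - 1 ∣ e * D := by
      rw [hD, ← Nat.gcd_mul_left]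
      refine Nat.dvd_gcd (dvd_mul_left _ _) ?_
      have h2 : e * univ.gcd b = univ.gcd fun i => e * b i := by
        rw [Finset.gcd_mul_left]; simp
      rw [h2]
      refine Finset.dvd_gcd fun i _ => ?_
      rw [hd, hβ i, mul_left_comm]
      exact mul_dvd_mul_left D (he i)
    rw [hd, mul_comm] at h1
    exact Nat.dvd_of_mul_dvd_mul_right hD0 h1
  obtain ⟨g, hgd, hg1⟩ := exists_pow_eq_one_mulChar_ne_one hθ hd1 (by rw [mul_comm, ← hd])
  set μ : Finset F := univ.filter fun y => y ^ d = 1 with hμ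
  have hμθ : ∑ y ∈ μ, θ y = 0 := by
    have hg0 : g ≠ 0 := by rintro rfl; rw [zero_pow (by omega)] at hgd; exact zero_ne_one hgd
    have h1 : θ g * ∑ y ∈ μ, θ y = ∑ y ∈ μ, θ y := by
      rw [mul_sum]
      refine sum_bij' (fun y _ => g * y) (fun y _ => g⁻¹ * y) ?_ ?_ ?_ ?_ ?_
      · intro y hy
        rw [hμ, mem_filter_univ] at hy ⊢
        rw [mul_pow, hgd, hy, one_mul]
      · intro y hy
        rw [hμ, mem_filter_univ] at hy ⊢
        rw [mul_pow, inv_pow, hgd, hy, inv_one, one_mul]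
      · intro y _; rw [inv_mul_cancel_left₀ hg0]
      · intro y _; rw [mul_inv_cancel_left₀ hg0]
      · intro y _; rw [map_mul]
    by_contra h
    exact hg1 (mul_eq_right₀ h |>.mp h1)
  have hμcard : #μ ≤ d := by
    have h1 : μ ⊆ (nthRoots d (1 : F)).toFinset := by
      intro y hy
      rw [hμ, mem_filter_univ] at hy
      rw [Multiset.mem_toFinset, mem_nthRoots (by omega), hy]
    exact (card_le_card h1).trans ((Multiset.toFinset_card_le _).trans (card_nthRoots d 1))
  have hμnorm : ∀ y ∈ μ, ‖θ y‖ ≤ 1 := by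
    intro y hy
    rw [hμ, mem_filter_univ] at hy
    refine (Complex.norm_eq_one_of_pow_eq_one (n := d) ?_ (by omega)).le
    rw [← map_pow, hy, map_one]
  set N := ∑ i, β i with hN
  refine ⟨(d * (4 * d * N + N + 11) + Fintype.card ι : ℕ), fun r hr K _ _ _ hK => ?_⟩
  have hpK : CharP K p := charP_of_injective_algebraMap (algebraMap F K).injective p
  have hpK' : ExpChar K p := ExpChar.prime hpp.out
  have hcardK : Fintype.card K = (q ^ r) ^ 2 := by
    rw [Module.card_eq_pow_finrank (K := F), hK, ← hq, ← pow_mul, mul_comm]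
  set M := q ^ r with hM
  have hMp : M = p ^ (s * r : ℕ) := by rw [hM, pow_mul, ← hqs]
  have hM1 : 1 ≤ M := Nat.one_le_pow _ _ (by omega)
  obtain ⟨w, hw⟩ : q - 1 ∣ M - 1 := by simpa using Nat.sub_dvd_pow_sub_pow q 1 r
  set E := D * w with hE
  have hdE : d * E + 1 = M := by
    have : d * E = M - 1 := by rw [hw, hd, hE]; ring
    omega
  have hQ : Fintype.card K - 1 = (q - 1) * (w * (M + 1)) := by
    rw [hcardK, ← mul_assoc, ← hw]
    have := Nat.sq_sub_sq M 1
    rw [one_pow] at this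
    rw [this, mul_comm]
  set f : K[X] := ∏ i, (X + C (algebraMap F K (a i))) ^ β i with hf
  have hfeval : ∀ x, f.eval x = ∏ i, (x + algebraMap F K (a i)) ^ β i := by
    intro x
    simp [hf, eval_prod]
  have hfN : f.natDegree ≤ N := by
    refine (natDegree_prod_le _ _).trans (sum_le_sum fun i _ => ?_)
    rw [natDegree_pow, natDegree_X_add_C, mul_one]
  have hfF : PowerFree f d := powerFree_prod ((algebraMap F K).injective.comp ha) hfree
  set G : Finset K := univ.filter fun x => ∀ i, x + algebraMap F K (a i) ≠ 0 with hG
  set c : K → F := fun x => ∏ i, Algebra.norm F (x + algebraMap F K (a i)) ^ b i with hc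
  have hcf : ∀ x, algebraMap F K (c x) = f.eval x ^ (E * (M + 1)) := by
    intro x
    rw [hc, map_prod, hfeval, ← prod_pow]
    refine prod_congr rfl fun i _ => ?_
    rw [map_pow, FiniteField.algebraMap_norm_eq_pow, Nat.card_eq_fintype_card,
      Nat.card_eq_fintype_card, hQ, ← hq, Nat.mul_div_cancel_left _ (by omega), ← pow_mul,
        ← pow_mul,
      hβ i, hE]
    congr 1
    ring
  have hGne : ∀ x ∈ G, ∀ i, x + algebraMap F K (a i) ≠ 0 := fun x hx => by
    rw [hG, mem_filter_univ] at hx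
    exact hx
  have hcμ : ∀ x ∈ G, c x ∈ μ := by
    intro x hx
    rw [hμ, mem_filter_univ, hc, ← prod_pow]
    refine prod_eq_one fun i _ => ?_
    have h1 : Algebra.norm F (x + algebraMap F K (a i)) ≠ 0 :=
      Algebra.norm_ne_zero_iff.mpr (hGne x hx i)
    rw [hβ i, ← pow_mul, mul_right_comm, ← hd, pow_mul, FiniteField.pow_card_sub_one_eq_one _ h1,
      one_pow]
  have hS : ∑ x : K, ∏ i, (θ ^ b i) (Algebra.norm F (x + algebraMap F K (a i))) =
      ∑ x ∈ G, θ (c x) := by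
    rw [← sum_subset (subset_univ G)]
    · refine sum_congr rfl fun x hx => ?_
      rw [hc, map_prod]
      refine prod_congr rfl fun i _ => ?_
      have h1 : Algebra.norm F (x + algebraMap F K (a i)) ≠ 0 :=
        Algebra.norm_ne_zero_iff.mpr (hGne x hx i)
      have h2 := MulChar.pow_apply_coe θ (b i) (Units.mk0 _ h1)
      rw [Units.val_mk0] at h2
      rw [h2, map_pow]
    · intro x _ hx
      rw [hG, mem_filter_univ] at hx
      push Not at hx
      obtain ⟨i, hi⟩ := hx
      refine prod_eq_zero (mem_univ i) ?_
      rw [hi, Algebra.norm_zero, MulChar.map_zero]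
  have hGcard : M ^ 2 ≤ #G + Fintype.card ι := by
    have h1 : (univ : Finset K) ⊆ G ∪ univ.image fun i => - algebraMap F K (a i) := by
      intro x _
      rw [mem_union, mem_image]
      by_cases hx : x ∈ G
      · exact Or.inl hx
      · rw [hG, mem_filter_univ] at hx
        push Not at hx
        obtain ⟨i, hi⟩ := hx
        exact Or.inr ⟨i, mem_univ i, (eq_neg_of_add_eq_zero_left hi).symm⟩
    have h2 := (card_le_card h1).trans (card_union_le _ _)
    rw [card_univ, hcardK] at h2
    exact h2.trans (Nat.add_le_add_left (card_image_le.trans card_univ.le) _)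
  have hcount : ∀ y ∈ μ, d * #{x ∈ G | c x = y} ≤ M ^ 2 + d * (4 * d * N + N + 11) * M := by
    intro y _
    have h1 := stepanov_bound (by omega : 0 < d) hfN hfF (p := p) (t := s * r) (E := E)
      (by rw [hdE, hMp]) (by rw [hcardK, hMp]) (algebraMap F K y)
    rw [← hMp] at h1
    refine le_trans (Nat.mul_le_mul_left d (card_le_card fun x hx => ?_)) h1
    rw [mem_filter] at hx
    rw [mem_filter_univ, ← hcf, hx.2]
    refine ⟨rfl, ?_⟩
    rw [hfeval]
    exact prod_ne_zero_iff.mpr fun i _ => pow_ne_zero _ (hGne x hx.1 i)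
  have hfinal := norm_sum_comp_le_of_card_le hμnorm hμθ hcμ (by omega : 0 < d) hμcard hcount
    (Z := d * (4 * d * N + N + 11) * M + Fintype.card ι) (by omega)
  rw [hS]
  refine hfinal.trans ?_
  have hsqrt : √(q : ℝ) ^ (2 * r) = (M : ℝ) := by
    rw [pow_mul, Real.sq_sqrt (Nat.cast_nonneg q), hM, Nat.cast_pow]
  rw [hsqrt, ← Nat.cast_mul, Nat.cast_le, add_mul]
  exact Nat.add_le_add_left (Nat.le_mul_of_pos_right _ hM1) _

theorem norm_sum_prod_mulChar_pow_le {F ι : Type*} [Field F] [Fintype F] [Fintype ι]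
    {θ : MulChar F ℂ} (hθ : orderOf θ = Fintype.card F - 1) {a : ι → F}
    (ha : Function.Injective a) {b : ι → ℕ} (hb : ∃ i, ¬ (Fintype.card F - 1) ∣ b i)
    (hι : 2 ≤ Fintype.card ι) :
    ‖∑ x, ∏ i, (θ ^ b i) (x + a i)‖ ≤ (Fintype.card ι - 1) * √(Fintype.card F) := by
  obtain ⟨A, hA⟩ := exists_norm_sum_le hθ ha hb
  refine norm_sum_mulChar_le_of_even ha ?_ hι hA
  obtain ⟨i, hi⟩ := hb
  exact ⟨i, fun h => hi (hθ ▸ orderOf_dvd_of_pow_eq_one h)⟩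

theorem not_dvd_sum_mul_div {m : ℕ} (hm : 0 < m) {j : m.primeFactors → ℕ} {l : m.primeFactors}
    (hj : ¬ (l : ℕ) ∣ j l) : ¬ m ∣ ∑ k : m.primeFactors, j k * (m / k) := by
  classical
  intro h
  have hp : ∀ k : m.primeFactors, (k : ℕ).Prime := fun k => Nat.prime_of_mem_primeFactors k.2
  have hdvd : ∀ k : m.primeFactors, (k : ℕ) ∣ m := fun k => Nat.dvd_of_mem_primeFactors k.2
  set R := ∏ k ∈ univ.erase l, (k : ℕ) with hR
  have h1 := h.mul_left R
  rw [← add_sum_erase univ _ (mem_univ l), mul_add] at h1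
  have h2 : m ∣ R * ∑ k ∈ univ.erase l, j k * (m / k) := by
    rw [mul_sum]
    refine dvd_sum fun k hk => ?_
    have h3 : m ∣ R * (m / k) := by
      obtain ⟨c, hc⟩ := dvd_prod_of_mem (fun k : m.primeFactors => (k : ℕ)) hk
      rw [hR, hc, mul_right_comm, Nat.mul_div_cancel' (hdvd k)]
      exact dvd_mul_right m c
    rw [mul_left_comm]
    exact h3.mul_left _
  have h3 := (Nat.dvd_add_left h2).mp h1
  have h4 : m * l ∣ m * (R * j l) := by
    have := mul_dvd_mul_right h3 (l : ℕ)
    rwa [← mul_assoc, mul_assoc, Nat.div_mul_cancel (hdvd l), mul_comm _ m] at this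
  have h5 := Nat.dvd_of_mul_dvd_mul_left hm h4
  rcases (hp l).dvd_mul.mp h5 with h6 | h6
  · obtain ⟨k, hk, hk'⟩ := (Prime.dvd_finsetProd_iff (hp l).prime _).mp h6
    exact ne_of_mem_erase hk (Subtype.ext ((Nat.prime_dvd_prime_iff_eq (hp l) (hp k)).mp hk').symm)
  · exact hj h6

/-- The coefficients expressing the indicator function of being no `l`-th power in terms of
multiplicative characters of order dividing `l`, up to scaling. -/
noncomputable def sieveWeight (l j : ℕ) : ℂ := if j = 0 then 1 else -1 / ((l : ℂ) - 1)

theorem sum_sieveWeight {l : ℕ} (hl : 1 < l) : ∑ j ∈ range l, sieveWeight l j = 0 := by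
  obtain ⟨m, rfl⟩ := Nat.exists_eq_succ_of_ne_zero (by omega : l ≠ 0)
  have hm : (m : ℂ) ≠ 0 := by exact_mod_cast (by omega : m ≠ 0)
  rw [sum_range_succ']
  simp [sieveWeight]
  field_simp
  ring

theorem sum_norm_sieveWeight {l : ℕ} (hl : 1 < l) : ∑ j ∈ range l, ‖sieveWeight l j‖ = 2 := by
  obtain ⟨m, rfl⟩ := Nat.exists_eq_succ_of_ne_zero (by omega : l ≠ 0)
  have hm : (m : ℝ) ≠ 0 := by exact_mod_cast (by omega : m ≠ 0)
  rw [sum_range_succ']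
  simp [sieveWeight]
  field_simp
  norm_num

theorem exists_forall_pow_ne_one {F ι : Type*} [Field F] [Fintype F] [Fintype ι] {a : ι → F}
    (ha : Function.Injective a) (hι : 2 ≤ Fintype.card ι)
    (hq : (2 ^ (Fintype.card ι * (Fintype.card F - 1).primeFactors.card) - 1) *
      ((Fintype.card ι - 1) * √(Fintype.card F)) < (Fintype.card F : ℝ) - Fintype.card ι) :
    ∃ x, ∀ i, x + a i ≠ 0 ∧ ∀ l ∈ (Fintype.card F - 1).primeFactors,
      (x + a i) ^ ((Fintype.card F - 1) / l) ≠ 1 := by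
  classical
  by_contra! hcon
  have hq1 : 1 < Fintype.card F := Fintype.one_lt_card
  set m := Fintype.card F - 1 with hm
  have hm0 : 0 < m := by omega
  obtain ⟨θ, hθ⟩ := MulChar.exists_mulChar_orderOf F (dvd_refl m)
    (Complex.isPrimitiveRoot_exp m hm0.ne')
  have hprime : ∀ l : m.primeFactors, (l : ℕ).Prime := fun l => Nat.prime_of_mem_primeFactors l.2
  set T : Finset (ι × m.primeFactors → ℕ) := Fintype.piFinset fun k => range k.2 with hT
  set W : (ι × m.primeFactors → ℕ) → ℂ := fun φ => ∏ k, sieveWeight k.2 (φ k) with hW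
  set b : (ι × m.primeFactors → ℕ) → ι → ℕ := fun φ i => ∑ l, φ (i, l) * (m / l) with hb
  set V : (ι × m.primeFactors → ℕ) → ℂ := fun φ => ∑ x, ∏ i, (θ ^ b φ i) (x + a i) with hV
  have hpow : ∀ (k : ℕ) (y : F), y ≠ 0 → (θ ^ k) y = θ y ^ k := by
    intro k y hy
    have := MulChar.pow_apply_coe θ k (Units.mk0 y hy)
    rwa [Units.val_mk0] at this
  have hzero : ∑ φ ∈ T, W φ * V φ = 0 := by
    simp only [hV, mul_sum]
    rw [sum_comm]
    refine sum_eq_zero fun x _ => ?_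
    by_cases hx : ∀ i, x + a i ≠ 0
    · obtain ⟨i, hi⟩ := hcon x
      obtain ⟨l, hl, hil⟩ := hi (hx i)
      have h1 : ∀ φ, W φ * ∏ i, (θ ^ b φ i) (x + a i) =
          ∏ k : ι × m.primeFactors, sieveWeight k.2 (φ k) * θ (x + a k.1) ^ (φ k * (m / k.2)) := by
        intro φ
        rw [hW, prod_mul_distrib, Fintype.prod_prod_type (fun k : ι × m.primeFactors =>
          θ (x + a k.1) ^ (φ k * (m / k.2)))]
        congr 1
        refine prod_congr rfl fun i _ => ?_
        rw [hpow _ _ (hx i)]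
        exact (prod_pow_eq_pow_sum univ (fun l => φ (i, l) * (m / l)) (θ (x + a i))).symm
      rw [sum_congr rfl fun φ _ => h1 φ, hT, ← prod_univ_sum
        (fun k : ι × m.primeFactors => range k.2)
        (fun k j => sieveWeight k.2 j * θ (x + a k.1) ^ (j * (m / k.2)))]
      refine prod_eq_zero (mem_univ (i, ⟨l, hl⟩)) ?_
      rw [← sum_sieveWeight (hprime ⟨l, hl⟩).one_lt]
      refine sum_congr rfl fun j _ => ?_
      rw [mul_comm j, pow_mul, ← map_pow]
      simp only [hil, map_one, one_pow, mul_one]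
    · push Not at hx
      obtain ⟨i, hi⟩ := hx
      refine sum_eq_zero fun φ _ => ?_
      rw [prod_eq_zero (mem_univ i) (by rw [hi, MulChar.map_zero]), mul_zero]
  have h0T : 0 ∈ T := by
    rw [hT, Fintype.mem_piFinset]
    exact fun k => mem_range.mpr (hprime k.2).pos
  have hW0 : W 0 = 1 := by simp [hW, sieveWeight]
  have hV0 : (Fintype.card F : ℝ) - Fintype.card ι ≤ ‖V 0‖ := by
    set G : Finset F := univ.filter fun x => ∀ i, x + a i ≠ 0 with hG
    have h1 : V 0 = #G := by
      have h2 : ∀ x, ∏ i, (θ ^ b 0 i) (x + a i) = if ∀ i, x + a i ≠ 0 then 1 else 0 := by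
        intro x
        split_ifs with hx
        · refine prod_eq_one fun i _ => ?_
          rw [hpow _ _ (hx i)]
          simp [hb]
        · push Not at hx
          obtain ⟨i, hi⟩ := hx
          exact prod_eq_zero (mem_univ i) (by rw [hi, MulChar.map_zero])
      exact (sum_congr rfl fun x _ => h2 x).trans (by rw [sum_boole, hG])
    have h2 : (univ : Finset F) ⊆ G ∪ univ.image fun i => - a i := by
      intro x _
      rw [mem_union, mem_image]
      by_cases hx : x ∈ G
      · exact Or.inl hx
      · rw [hG, mem_filter_univ] at hx
        push Not at hx
        obtain ⟨i, hi⟩ := hx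
        exact Or.inr ⟨i, mem_univ i, (eq_neg_of_add_eq_zero_left hi).symm⟩
    have h3 := (card_le_card h2).trans (card_union_le _ _)
    have h4 : Fintype.card F ≤ #G + Fintype.card ι :=
      h3.trans (Nat.add_le_add_left (card_image_le.trans card_univ.le) _)
    rw [h1, Complex.norm_natCast, sub_le_iff_le_add]
    exact_mod_cast h4
  have hVφ : ∀ φ ∈ T.erase 0, ‖W φ * V φ‖ ≤
      ‖W φ‖ * ((Fintype.card ι - 1) * √(Fintype.card F)) := by
    intro φ hφ
    rw [norm_mul]
    gcongr
    refine norm_sum_prod_mulChar_pow_le hθ ha ?_ hι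
    obtain ⟨⟨i, l⟩, hil⟩ := Function.ne_iff.mp (ne_of_mem_erase hφ)
    have hlt := mem_range.mp (Fintype.mem_piFinset.mp (mem_of_mem_erase hφ) (i, l))
    exact ⟨i, not_dvd_sum_mul_div hm0 (j := fun l => φ (i, l)) (l := l) fun h =>
      hlt.not_ge (Nat.le_of_dvd (Nat.pos_of_ne_zero hil) h)⟩
  have hWsum : ∑ φ ∈ T.erase 0, ‖W φ‖ = 2 ^ (Fintype.card ι * m.primeFactors.card) - 1 := by
    rw [eq_sub_iff_add_eq]
    have h1 : ‖W 0‖ = 1 := by rw [hW0, norm_one]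
    rw [← h1, sum_erase_add _ _ h0T]
    simp only [hW, norm_prod]
    rw [hT, ← prod_univ_sum (fun k : ι × m.primeFactors => range k.2)
      (fun k j => ‖sieveWeight k.2 j‖), prod_congr rfl fun k _ =>
      sum_norm_sieveWeight (hprime k.2).one_lt, prod_const, card_univ, Fintype.card_prod,
      Fintype.card_coe]
  rw [← add_sum_erase T _ h0T, hW0, one_mul] at hzero
  have hfin : ‖V 0‖ ≤ ∑ φ ∈ T.erase 0, ‖W φ‖ * ((Fintype.card ι - 1) * √(Fintype.card F)) := by
    rw [eq_neg_of_add_eq_zero_left hzero, norm_neg]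
    exact norm_sum_le_of_le _ hVφ
  rw [← sum_mul, hWsum] at hfin
  linarith

theorem isPrimitiveElem_of_pow_ne_one {F : Type*} [Field F] [Fintype F] {g : F} (hg : g ≠ 0)
    (h : ∀ l ∈ (Fintype.card F - 1).primeFactors, g ^ ((Fintype.card F - 1) / l) ≠ 1) :
    IsPrimitiveElem g := by
  classical
  have hq1 : 1 < Fintype.card F := Fintype.one_lt_card
  have hord : orderOf (Units.mk0 g hg) = Fintype.card F - 1 := by
    refine orderOf_eq_of_pow_and_pow_div_prime (by omega) ?_ fun l hl hdvd h1 => ?_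
    · rw [← Fintype.card_units, pow_card_eq_one]
    · refine h l (Nat.mem_primeFactors.mpr ⟨hl, hdvd, by omega⟩) ?_
      simpa using congrArg Units.val h1
  intro x hx
  have htop : Subgroup.zpowers (Units.mk0 g hg) = ⊤ := by
    refine Subgroup.eq_top_of_card_eq _ ?_
    rw [Nat.card_zpowers, hord, Nat.card_eq_fintype_card, Fintype.card_units]
  have hmem : Units.mk0 x hx ∈ Subgroup.zpowers (Units.mk0 g hg) := htop ▸ Subgroup.mem_top _
  obtain ⟨k, hk⟩ := (Submonoid.mem_powers_iff _ _).mp (mem_powers_iff_mem_zpowers.mpr hmem)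
  exact ⟨k, by simpa using congrArg Units.val hk⟩

theorem sieve_inequality {n s q : ℕ} (hn : 3 ≤ n) (hs : 8 ≤ s) (h : (n - 1) ^ 2 * s ^ 2 ≤ q) :
    ((s : ℝ) - 1) * (((n : ℝ) - 1) * √q) < q - n := by
  have hn' : (3 : ℝ) ≤ n := by exact_mod_cast hn
  have hs' : (8 : ℝ) ≤ s := by exact_mod_cast hs
  have h1 : (((n : ℝ) - 1) * s) ^ 2 ≤ q := by
    rw [mul_pow]
    have : (((n - 1 : ℕ) : ℝ)) ^ 2 * (s : ℝ) ^ 2 ≤ q := by exact_mod_cast h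
    rwa [Nat.cast_sub (by omega), Nat.cast_one] at this
  have h2 : ((n : ℝ) - 1) * s ≤ √q := Real.le_sqrt_of_sq_le h1
  have h3 : √q * √q = q := Real.mul_self_sqrt (Nat.cast_nonneg q)
  have h4 : (2 : ℝ) ≤ √q := by nlinarith
  have h5 : (n : ℝ) < (n - 1) * √q := by nlinarith
  have h6 := mul_le_mul_of_nonneg_right h2 (Real.sqrt_nonneg q)
  rw [h3] at h6
  linarith

end

/-- Basic criterion: if `3 ≤ n ≤ p` and `q ≥ (n-1)² · 2^{2 n ω(q-1)}`, then `𝔽_q`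
contains `n` consecutive primitive elements. -/
theorem consecutive_primitives_of_basic_bound (q p n : ℕ) (hq : IsPrimePow q)
    (F : Type*) [Field F] [Fintype F] (hF : Fintype.card F = q) (hp : CharP F p)
    (hn3 : 3 ≤ n) (hnp : n ≤ p)
    (hbound : (n - 1) ^ 2 * 2 ^ (2 * n * (q - 1).primeFactors.card) ≤ q) :
    HasConsecutivePrimitives F n := by
  subst hF
  have hp0 : Fintype.card F ≠ 1 := Fintype.one_lt_card.ne'
  have hpp : p.Prime := (CharP.char_is_prime_or_zero F p).resolve_right (by omega)
  have hpq : p ≤ Fintype.card F := by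
    have := Fact.mk hpp
    obtain ⟨s, -, hs⟩ := FiniteField.card F p
    rw [hs]
    exact Nat.le_self_pow s.ne_zero p
  have hω : 1 ≤ (Fintype.card F - 1).primeFactors.card :=
    card_pos.mpr (Nat.nonempty_primeFactors.mpr (by omega))
  have hinj : Function.Injective fun i : Fin n => ((i : ℕ) : F) := fun i j h =>
    Fin.ext (CharP.natCast_injOn_Iio F p (i.2.trans_le hnp) (j.2.trans_le hnp) h)
  have hineq : ((2 ^ (n * (Fintype.card F - 1).primeFactors.card) : ℕ) - 1 : ℝ) *
      (((n : ℝ) - 1) * √(Fintype.card F : ℝ)) < (Fintype.card F : ℝ) - n := by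
    refine sieve_inequality hn3 ?_ ?_
    · calc 8 = 2 ^ (3 * 1) := by norm_num
        _ ≤ _ := Nat.pow_le_pow_right (by norm_num) (Nat.mul_le_mul hn3 hω)
    · rwa [← pow_mul, mul_comm _ 2, ← mul_assoc]
  obtain ⟨g, hg⟩ := exists_forall_pow_ne_one hinj (by simp; omega) (by simpa using hineq)
  exact ⟨g, fun k hk => isPrimitiveElem_of_pow_ne_one (hg ⟨k, hk⟩).1 (hg ⟨k, hk⟩).2,
    fun i hi j hj h => CharP.natCast_injOn_Iio F p (hi.trans_le hnp) (hj.trans_le hnp)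
      (add_left_cancel h)⟩
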